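/- Let {ν_{nk}} be an infinitesimal array of probability measures on ℝ, {c_n}_{n≥1} ⊂ ℝ, γ ∈ ℝ, and σ a finite positive Borel measure on ℝ. For each n, let ω_n be a Borel probability measure on ℝ with E_{ω_n}(z) = c_n + Σ_{k=1}^{k_n} E_{ν_{nk}}(z) for all z ∈ ℂ⁺ (the additive boolean convolution δ_{c_n} ⊎ ν_{n1} ⊎ ⋯ ⊎ ν_{nk_n}), and let ν be the Borel probability measure with E_ν(z) = γ + ∫_ℝ (1+tz)/(z−t) dσ(t) for all z ∈ ℂ⁺ (the ⊎-infinitely divisible measure ν_⊎^{γ,σ}). Then ω_n converges weakly to ν if and only if the measures dσ_n(t) = Σ_{k=1}^{k_n} t²/(1+t²) dν_{nk}°(t) converge weakly on ℝ to σ and the numbers γ_n = c_n + Σ_{k=1}^{k_n} [a_{nk} + ∫_ℝ t/(1+t²) dν_{nk}°(t)] converge to γ. -/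

import Mathlib

open MeasureTheory Complex Filter Topology

noncomputable section

/-- Cauchy transform G_μ(z) = ∫ (z−t)⁻¹ dμ(t), z ∈ ℂ⁺. -/
def cauchyT (μ : Measure ℝ) (z : ℂ) : ℂ := ∫ t : ℝ, (z - (t : ℂ))⁻¹ ∂μ

/-- E_μ(z) = z − F_μ(z), where F_μ = 1/G_μ. -/
def ET (μ : Measure ℝ) (z : ℂ) : ℂ := z - (cauchyT μ z)⁻¹

/-- Infinitesimal triangular array on ℝ: max_{1≤k≤k_n} ν_{nk}{|t| ≥ ε} → 0 as n → ∞. -/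
def IsInfinitesimalArrayR (kn : ℕ → ℕ) (ν : ℕ → ℕ → Measure ℝ) : Prop :=
  ∀ ε : ℝ, 0 < ε → ∀ δ : ENNReal, 0 < δ → ∃ N : ℕ, ∀ n ≥ N, ∀ i < kn n,
    ν n i {t : ℝ | ε ≤ |t|} < δ

/-- a = ∫_{|t|<1} t dν(t). -/
def aR (ν : Measure ℝ) : ℝ := ∫ t in {t : ℝ | |t| < 1}, t ∂ν

/-- ν° : the centering of ν, pushforward under t ↦ t − a. -/
def centerR (ν : Measure ℝ) : Measure ℝ := Measure.map (fun t => t - aR ν) ν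

/-- f(z) = ∫ tz/(z−t) dν°(t). -/
def fR (ν : Measure ℝ) (z : ℂ) : ℂ :=
  ∫ t : ℝ, ((t : ℂ) * z) / (z - (t : ℂ)) ∂(centerR ν)

lemma im_le_norm_sub_ofReal (z : ℂ) (s : ℝ) : z.im ≤ ‖z - s‖ := by
  have h := Complex.abs_im_le_norm (z - s)
  simp only [sub_im, ofReal_im, sub_zero] at h
  exact (le_abs_self _).trans h

lemma sub_ofReal_ne_zero {z : ℂ} (hz : 0 < z.im) (s : ℝ) : z - s ≠ 0 :=
  norm_pos_iff.1 (hz.trans_le (im_le_norm_sub_ofReal z s))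

lemma one_add_sq_le_mul_norm_sub_sq {z : ℂ} {y R : ℝ} (hy : 0 < y) (hz : y ≤ z.im) (hR : ‖z‖ ≤ R)
    (s : ℝ) : 1 + s ^ 2 ≤ (2 + (1 + 2 * R ^ 2) / y ^ 2) * ‖z - s‖ ^ 2 := by
  have h1 : y ≤ ‖z - s‖ := hz.trans (im_le_norm_sub_ofReal z s)
  have h2 : |s| ≤ R + ‖z - s‖ := by
    have h := norm_sub_le z (z - s)
    rw [sub_sub_cancel, norm_real, Real.norm_eq_abs] at h
    linarith
  have h3 : s ^ 2 ≤ (R + ‖z - s‖) ^ 2 := sq_le_sq' (by linarith [neg_abs_le s])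
    ((le_abs_self s).trans h2)
  have h4 : y ^ 2 ≤ ‖z - s‖ ^ 2 := by gcongr
  have h5 : 1 + 2 * R ^ 2 ≤ (1 + 2 * R ^ 2) / y ^ 2 * ‖z - s‖ ^ 2 := by
    rw [div_mul_eq_mul_div, le_div_iff₀ (by positivity)]
    gcongr
  nlinarith [sq_nonneg (R - ‖z - s‖)]

/-- The kernel of the Nevanlinna representation of `ET` is bounded in the integration variable. -/
lemma exists_norm_nevanlinna_kernel_le {z : ℂ} (hz : 0 < z.im) :
    ∃ C : ℝ, 0 ≤ C ∧ ∀ s : ℝ, ‖(1 + (s : ℂ) * z) / (z - s)‖ ≤ C := by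
  set D := 2 + (1 + 2 * ‖z‖ ^ 2) / z.im ^ 2 with hD
  have hD0 : 0 ≤ D := by positivity
  refine ⟨√((1 + ‖z‖ ^ 2) * D), by positivity, fun s => Real.le_sqrt_of_sq_le ?_⟩
  have h1 := one_add_sq_le_mul_norm_sub_sq hz le_rfl le_rfl s
  have h2 : 0 < ‖z - s‖ := hz.trans_le (im_le_norm_sub_ofReal z s)
  have h3 : ‖1 + (s : ℂ) * z‖ ≤ 1 + |s| * ‖z‖ := by
    simpa using norm_add_le (1 : ℂ) ((s : ℂ) * z)
  rw [norm_div, div_pow, div_le_iff₀ (by positivity)]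
  calc ‖1 + (s : ℂ) * z‖ ^ 2 ≤ (1 + |s| * ‖z‖) ^ 2 := by gcongr
    _ ≤ (1 + ‖z‖ ^ 2) * (1 + s ^ 2) := by
      rw [← sq_abs s]; nlinarith [sq_nonneg (|s| - ‖z‖)]
    _ ≤ (1 + ‖z‖ ^ 2) * (D * ‖z - s‖ ^ 2) := by gcongr
    _ = _ := by ring

instance isProbabilityMeasure_centerR (ν : Measure ℝ) [IsProbabilityMeasure ν] :
    IsProbabilityMeasure (centerR ν) :=
  Measure.isProbabilityMeasure_map (by fun_prop)

lemma measureReal_le_of_lt_ofReal {ν : Measure ℝ} {ε : ℝ} (hε : 0 < ε)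
    (h : ν {t : ℝ | ε ≤ |t|} < ENNReal.ofReal ε) : ν.real {t : ℝ | ε ≤ |t|} ≤ ε :=
  ENNReal.toReal_le_of_le_ofReal hε.le h.le

lemma measurableSet_le_abs (ε : ℝ) : MeasurableSet {t : ℝ | ε ≤ |t|} :=
  measurableSet_le measurable_const measurable_id.abs

/-- A function that is small near zero and bounded has a small integral against a measure that is
concentrated near zero. -/
lemma norm_integral_le_of_concentrated {E : Type*} [NormedAddCommGroup E] [NormedSpace ℝ E]
    {ν : Measure ℝ} [IsProbabilityMeasure ν] {ε A B : ℝ} (hε : 0 < ε) (hB : 0 ≤ B)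
    (h : ν {t : ℝ | ε ≤ |t|} < ENNReal.ofReal ε) {g : ℝ → E}
    (h1 : ∀ t, |t| < ε → ‖g t‖ ≤ A) (h2 : ∀ t, ‖g t‖ ≤ B) : ‖∫ t, g t ∂ν‖ ≤ A + B * ε := by
  have hA : 0 ≤ A := (norm_nonneg _).trans (h1 0 (by simpa using hε))
  have hi : Integrable (fun t => A + {t : ℝ | ε ≤ |t|}.indicator (fun _ => B) t) ν :=
    (integrable_const A).add ((integrable_const B).indicator (measurableSet_le_abs ε))
  refine (norm_integral_le_of_norm_le hi (ae_of_all _ fun t => ?_)).trans ?_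
  · by_cases ht : ε ≤ |t|
    · simpa [ht] using (h2 t).trans (by linarith)
    · simpa [ht] using h1 t (not_le.1 ht)
  · rw [integral_add (integrable_const A)
      ((integrable_const B).indicator (measurableSet_le_abs ε)),
      integral_indicator_const _ (measurableSet_le_abs ε)]
    have := measureReal_le_of_lt_ofReal hε h
    simp only [integral_const, probReal_univ, smul_eq_mul, one_mul]
    nlinarith

lemma abs_aR_le {ν : Measure ℝ} [IsProbabilityMeasure ν] {ε : ℝ} (hε : 0 < ε)
    (h : ν {t : ℝ | ε ≤ |t|} < ENNReal.ofReal ε) : |aR ν| ≤ 2 * ε := by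
  have hm : MeasurableSet {t : ℝ | |t| < 1} := measurableSet_lt measurable_id.abs measurable_const
  rw [aR, ← integral_indicator hm, ← Real.norm_eq_abs]
  refine (norm_integral_le_of_concentrated (A := ε) (B := 1) hε zero_le_one h ?_ ?_).trans
    (by linarith)
  · intro t ht
    by_cases h1 : |t| < 1
    · simpa [h1] using ht.le
    · simpa [h1] using hε.le
  · intro t
    by_cases h1 : |t| < 1
    · simpa [h1] using h1.le
    · simp [h1]

/-- `∫ t² / (1 + t²)` for the centering of `ν`. -/
def centeredMass (ν : Measure ℝ) : ℝ := ∫ t : ℝ, t ^ 2 / (1 + t ^ 2) ∂(centerR ν)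

lemma sq_div_one_add_sq_nonneg (t : ℝ) : 0 ≤ t ^ 2 / (1 + t ^ 2) := by positivity

lemma sq_div_one_add_sq_le_one (t : ℝ) : t ^ 2 / (1 + t ^ 2) ≤ 1 := by
  rw [div_le_one (by positivity)]; linarith

lemma integrable_sq_div_one_add_sq (μ : Measure ℝ) [IsFiniteMeasure μ] :
    Integrable (fun t : ℝ => t ^ 2 / (1 + t ^ 2)) μ :=
  Integrable.of_bound (Measurable.aestronglyMeasurable (by fun_prop)) 1 (ae_of_all _ fun t => by
    rw [Real.norm_eq_abs, abs_of_nonneg (sq_div_one_add_sq_nonneg t)]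
    exact sq_div_one_add_sq_le_one t)

lemma abs_div_one_add_sq_le_one (t : ℝ) : |t / (1 + t ^ 2)| ≤ 1 := by
  rw [abs_div, abs_of_pos (by positivity : 0 < 1 + t ^ 2), div_le_one (by positivity)]
  rw [← sq_abs t]; nlinarith [sq_nonneg (|t| - 1)]

lemma integrable_div_one_add_sq (μ : Measure ℝ) [IsFiniteMeasure μ] :
    Integrable (fun t : ℝ => t / (1 + t ^ 2)) μ :=
  Integrable.of_bound (Measurable.aestronglyMeasurable (by fun_prop)) 1 (ae_of_all _ abs_div_one_add_sq_le_one)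

lemma centeredMass_nonneg (ν : Measure ℝ) : 0 ≤ centeredMass ν :=
  integral_nonneg sq_div_one_add_sq_nonneg

lemma abs_integral_div_one_add_sq_le {ν : Measure ℝ} [IsProbabilityMeasure ν]
    (ha : |aR ν| ≤ 1 / 2) :
    |∫ t : ℝ, t / (1 + t ^ 2) ∂(centerR ν)| ≤ 10 * centeredMass ν := by
  set a := aR ν with ha'
  have hm : MeasurableSet {t : ℝ | |t| < 1} := measurableSet_lt measurable_id.abs measurable_const
  have hi1 : Integrable (fun t : ℝ => t) (ν.restrict {t : ℝ | |t| < 1}) :=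
    Integrable.of_bound (by fun_prop) 1
      ((ae_restrict_iff' hm).2 (ae_of_all _ fun t ht => le_of_lt ht))
  have hb : ∫ t : ℝ, t / (1 + t ^ 2) ∂(centerR ν)
      = ∫ t : ℝ, (t - a) / (1 + (t - a) ^ 2) ∂ν := by
    rw [centerR, integral_map (by fun_prop) (Measurable.aestronglyMeasurable (by fun_prop))]
  have hmass : centeredMass ν = ∫ t : ℝ, (t - a) ^ 2 / (1 + (t - a) ^ 2) ∂ν := by
    rw [centeredMass, centerR, integral_map (by fun_prop) (Measurable.aestronglyMeasurable (by fun_prop))]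
  have hig : Integrable (fun t : ℝ => (t - a) / (1 + (t - a) ^ 2)) ν :=
    Integrable.of_bound (Measurable.aestronglyMeasurable (by fun_prop)) 1 (ae_of_all _ fun t => abs_div_one_add_sq_le_one (t - a))
  have him : Integrable (fun t : ℝ => (t - a) ^ 2 / (1 + (t - a) ^ 2)) ν :=
    Integrable.of_bound (Measurable.aestronglyMeasurable (by fun_prop)) 1 (ae_of_all _ fun t => by
      rw [Real.norm_eq_abs, abs_of_nonneg (sq_div_one_add_sq_nonneg (t - a))]
      exact sq_div_one_add_sq_le_one (t - a))
  have hil : Integrable (fun t : ℝ => {t : ℝ | |t| < 1}.indicator (fun t => t) t - a) ν :=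
    (((integrable_indicator_iff hm).2 hi1)).sub (integrable_const a)
  have hzero : ∫ t : ℝ, ({t : ℝ | |t| < 1}.indicator (fun t => t) t - a) ∂ν = 0 := by
    rw [integral_sub ((integrable_indicator_iff hm).2 hi1) (integrable_const a),
      integral_indicator hm, ha', aR]
    simp
  rw [hb, hmass, ← sub_zero (∫ t : ℝ, (t - a) / (1 + (t - a) ^ 2) ∂ν), ← hzero,
    ← integral_sub hig hil, ← integral_const_mul, ← Real.norm_eq_abs]
  refine norm_integral_le_of_norm_le (him.const_mul 10) (ae_of_all _ fun t => ?_)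
  rw [Real.norm_eq_abs]
  obtain ⟨ha1, ha2⟩ := abs_le.1 ha
  have hp : 0 < 1 + (t - a) ^ 2 := by positivity
  by_cases ht : |t| < 1
  · have he : (t - a) / (1 + (t - a) ^ 2) - (t - a)
        = (-(t - a)) * ((t - a) ^ 2 / (1 + (t - a) ^ 2)) := by
      field_simp; ring
    have h0 := sq_div_one_add_sq_nonneg (t - a)
    simp only [Set.indicator, Set.mem_ofPred_eq, ht, if_true]
    rw [he, abs_mul, abs_of_nonneg h0]
    obtain ⟨h1, h2⟩ := abs_lt.1 ht
    refine mul_le_mul_of_nonneg_right ?_ h0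
    rw [abs_le]; constructor <;> linarith
  · simp only [Set.indicator, Set.mem_ofPred_eq, ht, if_false]
    rw [zero_sub, sub_neg_eq_add]
    have hs : 1 / 2 ≤ |t - a| := by
      have := abs_sub_abs_le_abs_sub t a
      linarith [not_lt.1 ht]
    have h4 : 1 / 4 ≤ (t - a) ^ 2 := by rw [← sq_abs]; nlinarith
    have h5 : |(t - a) / (1 + (t - a) ^ 2)| ≤ 2 * ((t - a) ^ 2 / (1 + (t - a) ^ 2)) := by
      rw [abs_div, abs_of_pos hp, mul_div_assoc', div_le_div_iff_of_pos_right hp, ← sq_abs (t - a)]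
      nlinarith
    have h6 : 1 / 5 ≤ (t - a) ^ 2 / (1 + (t - a) ^ 2) := by
      rw [le_div_iff₀ hp]; linarith
    refine (abs_add_le _ _).trans ?_
    linarith

lemma abs_sub_div_norm_sub_le {z : ℂ} (hz : 0 < z.im) {a ε t : ℝ} (ha : |a| ≤ 2 * ε)
    (ht : |t| < ε) : ‖((t - a : ℝ) : ℂ) / (z - t)‖ ≤ 3 * ε / z.im := by
  rw [norm_div, norm_real, Real.norm_eq_abs]
  have := abs_sub t a
  have := norm_nonneg (z - t)
  exact div_le_div₀ (by linarith [abs_nonneg t]) (by linarith) hz (im_le_norm_sub_ofReal z t)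

lemma norm_sub_div_norm_sub_le {z : ℂ} (hz : 0 < z.im) {a t : ℝ} (ha : |a| ≤ 1) :
    ‖((t - a : ℝ) : ℂ) / (z - t)‖ ≤ 1 + (‖z‖ + 1) / z.im := by
  have h1 := im_le_norm_sub_ofReal z t
  have h2 : 0 < ‖z - t‖ := hz.trans_le h1
  rw [norm_div, div_le_iff₀ h2]
  have h3 : ‖((t - a : ℝ) : ℂ)‖ ≤ ‖z - t‖ + (‖z‖ + 1) := by
    have h := norm_sub_le (z - a) (z - t)
    have h' := norm_sub_le z (a : ℂ)
    rw [norm_real, Real.norm_eq_abs] at h'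
    have : ((t - a : ℝ) : ℂ) = (z - a) - (z - t) := by push_cast; ring
    rw [this]; linarith
  have h4 : ‖z‖ + 1 ≤ (‖z‖ + 1) / z.im * ‖z - t‖ := by
    rw [div_mul_eq_mul_div, le_div_iff₀ hz]; gcongr
  linarith

/-- For `ν` concentrated near `0`, `ET ν z` is given to first order by the centering of `ν`. -/
lemma exists_norm_ET_sub_le {z : ℂ} (hz : 0 < z.im) :
    ∃ C ε₀ : ℝ, 0 ≤ C ∧ 0 < ε₀ ∧ ∀ ν : Measure ℝ, IsProbabilityMeasure ν → ∀ ε : ℝ, 0 < ε →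
      ε ≤ ε₀ → ν {t : ℝ | ε ≤ |t|} < ENNReal.ofReal ε →
      ‖ET ν z - (((aR ν + ∫ t : ℝ, t / (1 + t ^ 2) ∂(centerR ν) : ℝ) : ℂ)
        + ∫ t : ℝ, ((t ^ 2 / (1 + t ^ 2) : ℝ) : ℂ) * ((1 + (t : ℂ) * z) / (z - t))
          ∂(centerR ν))‖ ≤ C * ε * centeredMass ν := by
  obtain ⟨K, hK0, hK⟩ := exists_norm_nevanlinna_kernel_le hz
  set D := 2 + (1 + 2 * (‖z‖ + 1) ^ 2) / z.im ^ 2 with hD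
  have hD0 : 0 ≤ D := by positivity
  set H := 3 / z.im + (1 + (‖z‖ + 1) / z.im) with hH
  have hH0 : 0 < H := by positivity
  refine ⟨2 * (2 * D + (10 + K) * H), min (1 / 4) (1 / (2 * H)), by positivity, by positivity,
    fun ν hν ε hε hε0 hconc => ?_⟩
  have hε1 : ε ≤ 1 / 4 := hε0.trans (min_le_left _ _)
  have hε2 : H * ε ≤ 1 / 2 := by
    have := hε0.trans (min_le_right _ _)
    rw [le_div_iff₀ (by positivity)] at this
    linarith
  have ha := abs_aR_le hε hconc
  set a := aR ν with ha'
  set w : ℂ := z - a with hw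
  have hwim : w.im = z.im := by simp [hw]
  have hw0 : 0 < w.im := hwim ▸ hz
  have hwR : ‖w‖ ≤ ‖z‖ + 1 := by
    refine (norm_sub_le _ _).trans ?_
    rw [norm_real, Real.norm_eq_abs]; linarith
  have hwne : w ≠ 0 := by simpa using sub_ofReal_ne_zero hw0 0
  set κ := centerR ν with hκ
  have : IsProbabilityMeasure κ := isProbabilityMeasure_centerR ν
  set h : ℂ := ∫ s : ℝ, (s : ℂ) / (w - s) ∂κ with hh
  have hh' : h = ∫ t : ℝ, ((t - a : ℝ) : ℂ) / (z - t) ∂ν := by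
    rw [hh, hκ, centerR, integral_map (by fun_prop)
      (Measurable.aestronglyMeasurable (by fun_prop))]
    refine integral_congr_ae (ae_of_all _ fun t => ?_)
    simp [hw, ← ha']
  have hhle : ‖h‖ ≤ H * ε := by
    rw [hh']
    refine (norm_integral_le_of_concentrated (A := 3 * ε / z.im) (B := 1 + (‖z‖ + 1) / z.im) hε
      (by positivity) hconc (fun t ht => abs_sub_div_norm_sub_le hz ha ht)
      (fun t => norm_sub_div_norm_sub_le hz (by linarith))).trans (le_of_eq ?_)
    rw [hH]; ring
  have hih : Integrable (fun t : ℝ => ((t - a : ℝ) : ℂ) / (z - t)) ν :=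
    Integrable.of_bound (Measurable.aestronglyMeasurable (by fun_prop)) _
      (ae_of_all _ fun t => norm_sub_div_norm_sub_le hz (by linarith))
  have hih' : Integrable (fun s : ℝ => (s : ℂ) / (w - s)) κ := by
    rw [hκ, centerR, integrable_map_measure (Measurable.aestronglyMeasurable (by fun_prop))
      (by fun_prop)]
    refine hih.congr (ae_of_all _ fun t => ?_)
    simp [hw, ← ha']
  have hG : cauchyT ν z = w⁻¹ * (1 + h) := by
    have : ∀ t : ℝ, (z - (t : ℂ))⁻¹ = w⁻¹ * (1 + ((t - a : ℝ) : ℂ) / (z - t)) := by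
      intro t
      have := sub_ofReal_ne_zero hz t
      field_simp
      rw [hw]; push_cast; ring
    rw [cauchyT, hh']
    simp_rw [this]
    rw [integral_const_mul, integral_add (integrable_const _) hih]
    simp
  set b : ℝ := ∫ t : ℝ, t / (1 + t ^ 2) ∂κ with hb
  set k : ℂ := ∫ t : ℝ, ((t ^ 2 / (1 + t ^ 2) : ℝ) : ℂ) * ((1 + (t : ℂ) * z) / (z - t)) ∂κ
    with hk
  have him := integrable_sq_div_one_add_sq κ
  have hkb : ∀ t : ℝ, ‖((t ^ 2 / (1 + t ^ 2) : ℝ) : ℂ) * ((1 + (t : ℂ) * z) / (z - t))‖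
      ≤ K * (t ^ 2 / (1 + t ^ 2)) := by
    intro t
    rw [norm_mul, norm_real, Real.norm_eq_abs, abs_of_nonneg (sq_div_one_add_sq_nonneg t), mul_comm]
    exact mul_le_mul_of_nonneg_right (hK t) (sq_div_one_add_sq_nonneg t)
  have hki : Integrable
      (fun t : ℝ => ((t ^ 2 / (1 + t ^ 2) : ℝ) : ℂ) * ((1 + (t : ℂ) * z) / (z - t))) κ :=
    (him.const_mul K).mono' (Measurable.aestronglyMeasurable (by fun_prop)) (ae_of_all _ hkb)
  have hkle : ‖k‖ ≤ K * centeredMass ν := by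
    rw [centeredMass, ← integral_const_mul]
    exact norm_integral_le_of_norm_le (him.const_mul K) (ae_of_all _ hkb)
  have hble : |b| ≤ 10 * centeredMass ν := abs_integral_div_one_add_sq_le (by linarith)
  have he : ‖w * h - (b + k)‖ ≤ |a| * D * centeredMass ν := by
    have hbi : Integrable (fun t : ℝ => ((t / (1 + t ^ 2) : ℝ) : ℂ)) κ :=
      (integrable_div_one_add_sq κ).ofReal
    have hbki : Integrable (fun t : ℝ => ((t / (1 + t ^ 2) : ℝ) : ℂ)
        + ((t ^ 2 / (1 + t ^ 2) : ℝ) : ℂ) * ((1 + (t : ℂ) * z) / (z - t))) κ := hbi.add hki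
    rw [hh, hb, hk, ← integral_const_mul, ← integral_complex_ofReal, ← integral_add hbi hki,
      ← integral_sub (hih'.const_mul w) hbki, centeredMass, ← integral_const_mul]
    refine norm_integral_le_of_norm_le (him.const_mul _) (ae_of_all _ fun s => ?_)
    have h1 := sub_ofReal_ne_zero hz s
    have h2 := sub_ofReal_ne_zero hw0 s
    have h3 : (1 + (s : ℂ) ^ 2) ≠ 0 := by
      have : (1 + s ^ 2 : ℝ) ≠ 0 := by positivity
      exact_mod_cast this
    have heq : w * ((s : ℂ) / (w - s)) - (((s / (1 + s ^ 2) : ℝ) : ℂ)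
        + ((s ^ 2 / (1 + s ^ 2) : ℝ) : ℂ) * ((1 + (s : ℂ) * z) / (z - s)))
        = (a : ℂ) * (s : ℂ) ^ 2 / ((w - s) * (z - s)) := by
      have haw : (a : ℂ) = z - w := by rw [hw]; ring
      rw [haw]
      push_cast
      field_simp
      ring
    rw [heq, norm_div, norm_mul, norm_mul, norm_pow, norm_real, norm_real, Real.norm_eq_abs,
      Real.norm_eq_abs, sq_abs, mul_assoc |a|, mul_div_assoc]
    refine mul_le_mul_of_nonneg_left ?_ (abs_nonneg a)
    have h4 : 0 < ‖w - s‖ * ‖z - s‖ := mul_pos (norm_pos_iff.2 h2) (norm_pos_iff.2 h1)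
    have h5 := one_add_sq_le_mul_norm_sub_sq hz hwim.ge hwR s
    have h6 := one_add_sq_le_mul_norm_sub_sq (R := ‖z‖ + 1) hz le_rfl (by linarith) s
    have h7 : 1 + s ^ 2 ≤ D * (‖w - s‖ * ‖z - s‖) := by
      refine le_of_sq_le_sq ?_ (by positivity)
      calc (1 + s ^ 2) ^ 2 = (1 + s ^ 2) * (1 + s ^ 2) := by ring
        _ ≤ (D * ‖w - s‖ ^ 2) * (D * ‖z - s‖ ^ 2) := by gcongr
        _ = _ := by ring
    rw [mul_div_assoc', div_le_div_iff₀ h4 (by positivity)]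
    nlinarith [sq_nonneg s]
  have h1h : 1 / 2 ≤ ‖1 + h‖ := by
    have := norm_sub_norm_le (1 : ℂ) (-h)
    rw [norm_neg, sub_neg_eq_add, norm_one] at this
    linarith
  have h1hne : 1 + h ≠ 0 := norm_pos_iff.1 (by linarith)
  have hET : ET ν z - (((a + b : ℝ) : ℂ) + k) = ((w * h - (b + k)) - (b + k) * h) / (1 + h) := by
    rw [ET, hG, mul_inv, inv_inv]
    have : z = w + a := by rw [hw]; ring
    rw [eq_div_iff h1hne, this]
    push_cast
    field_simp
    ring
  have hm := centeredMass_nonneg ν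
  have hf : ‖(b : ℂ) + k‖ ≤ (10 + K) * centeredMass ν := by
    refine (norm_add_le _ _).trans ?_
    rw [norm_real, Real.norm_eq_abs]; linarith
  rw [hET, norm_div, div_le_iff₀ (by linarith)]
  have hnum : ‖(w * h - (b + k)) - (b + k) * h‖
      ≤ (2 * D + (10 + K) * H) * ε * centeredMass ν := by
    refine (norm_sub_le _ _).trans ?_
    rw [norm_mul]
    calc ‖w * h - (b + k)‖ + ‖(b : ℂ) + k‖ * ‖h‖
        ≤ 2 * ε * D * centeredMass ν + (10 + K) * centeredMass ν * (H * ε) := by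
          refine add_le_add (he.trans ?_) ?_
          · gcongr
          · gcongr
      _ = _ := by ring
  refine hnum.trans ?_
  have : 0 ≤ (2 * D + (10 + K) * H) * ε * centeredMass ν := by positivity
  nlinarith

lemma im_inv_sub_ofReal (x y t : ℝ) :
    (((x : ℂ) + y * I - t)⁻¹).im = -(y / ((x - t) ^ 2 + y ^ 2)) := by
  rw [Complex.inv_im, Complex.normSq_apply]
  simp
  ring

lemma continuous_inv_sub_ofReal {z : ℂ} (hz : 0 < z.im) :
    Continuous (fun t : ℝ => (z - (t : ℂ))⁻¹) :=
  (continuous_const.sub continuous_ofReal).inv₀ fun t => sub_ofReal_ne_zero hz t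

lemma norm_inv_sub_ofReal_le {z : ℂ} (hz : 0 < z.im) (t : ℝ) : ‖(z - (t : ℂ))⁻¹‖ ≤ z.im⁻¹ := by
  rw [norm_inv]
  exact inv_anti₀ hz (im_le_norm_sub_ofReal z t)

lemma integrable_inv_sub_ofReal (μ : Measure ℝ) [IsFiniteMeasure μ] {z : ℂ} (hz : 0 < z.im) :
    Integrable (fun t : ℝ => (z - (t : ℂ))⁻¹) μ :=
  Integrable.of_bound (continuous_inv_sub_ofReal hz).aestronglyMeasurable _
    (ae_of_all _ (norm_inv_sub_ofReal_le hz))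

lemma im_cauchyT (μ : Measure ℝ) [IsFiniteMeasure μ] {z : ℂ} (hz : 0 < z.im) :
    (cauchyT μ z).im = ∫ t : ℝ, ((z - (t : ℂ))⁻¹).im ∂μ :=
  (integral_im (𝕜 := ℂ) (integrable_inv_sub_ofReal μ hz)).symm

lemma norm_cauchyT_le (μ : Measure ℝ) [IsFiniteMeasure μ] {z : ℂ} (hz : 0 < z.im) :
    ‖cauchyT μ z‖ ≤ z.im⁻¹ * μ.real Set.univ :=
  norm_integral_le_of_norm_le_const (ae_of_all _ (norm_inv_sub_ofReal_le hz))

lemma cauchyT_ne_zero (μ : Measure ℝ) [IsProbabilityMeasure μ] {z : ℂ} (hz : 0 < z.im) :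
    cauchyT μ z ≠ 0 := by
  intro h
  have h1 := im_cauchyT μ hz
  rw [h, zero_im] at h1
  have hpos : ∀ t : ℝ, 0 < -((z - (t : ℂ))⁻¹).im := by
    intro t
    rw [Complex.inv_im, ← neg_div, neg_neg]
    exact div_pos (by simpa using hz) (Complex.normSq_pos.2 (sub_ofReal_ne_zero hz t))
  have hi : Integrable (fun t : ℝ => -((z - (t : ℂ))⁻¹).im) μ :=
    (integrable_inv_sub_ofReal μ hz).im.neg
  have h2 : 0 < ∫ t : ℝ, -((z - (t : ℂ))⁻¹).im ∂μ := by
    rw [integral_pos_iff_support_of_nonneg (fun t => (hpos t).le) hi]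
    have : Function.support (fun t : ℝ => -((z - (t : ℂ))⁻¹).im) = Set.univ :=
      Set.eq_univ_of_forall fun t => (hpos t).ne'
    rw [this]
    simp
  rw [integral_neg, ← h1] at h2
  simp at h2

lemma continuous_cauchyT_horizontal (μ : Measure ℝ) [IsFiniteMeasure μ] {y : ℝ} (hy : 0 < y) :
    Continuous (fun x : ℝ => cauchyT μ ((x : ℂ) + y * I)) := by
  have him : ∀ x : ℝ, ((x : ℂ) + y * I).im = y := by simp
  refine continuous_of_dominated (bound := fun _ => y⁻¹)
    (fun x => (continuous_inv_sub_ofReal (by rw [him]; exact hy)).aestronglyMeasurable)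
    (fun x => ae_of_all _ fun t => ?_) (integrable_const _) (ae_of_all _ fun t => ?_)
  · simpa [him] using norm_inv_sub_ofReal_le (z := (x : ℂ) + y * I) (by rw [him]; exact hy) t
  · exact Continuous.inv₀ (by fun_prop)
      fun x => sub_ofReal_ne_zero (z := (x : ℂ) + y * I) (by rw [him]; exact hy) t

/-- Unnormalised Poisson kernel of the upper half plane. -/
def halfPlanePoisson (y x t : ℝ) : ℝ := y / ((x - t) ^ 2 + y ^ 2)

lemma continuous_halfPlanePoisson {y : ℝ} (hy : 0 < y) :
    Continuous (fun p : ℝ × ℝ => halfPlanePoisson y p.1 p.2) :=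
  Continuous.div (by fun_prop) (by fun_prop) fun p => by positivity

lemma abs_halfPlanePoisson_le {y : ℝ} (hy : 0 < y) (x t : ℝ) : |halfPlanePoisson y x t| ≤ y⁻¹ := by
  rw [halfPlanePoisson, abs_of_nonneg (by positivity), div_le_iff₀ (by positivity)]
  field_simp
  nlinarith [sq_nonneg (x - t)]

lemma integrable_uncurry_mul_halfPlanePoisson (μ : Measure ℝ) [IsFiniteMeasure μ] {f : ℝ → ℝ}
    (hf : Integrable f) {y : ℝ} (hy : 0 < y) :
    Integrable (Function.uncurry fun t x => f x * halfPlanePoisson y x t) (μ.prod volume) :=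
  (hf.comp_snd μ).mul_bdd (c := y⁻¹) ((continuous_halfPlanePoisson hy).comp
    continuous_swap).aestronglyMeasurable (ae_of_all _ fun _ => abs_halfPlanePoisson_le hy _ _)

lemma integral_integral_mul_halfPlanePoisson (μ : Measure ℝ) [IsFiniteMeasure μ] {f : ℝ → ℝ}
    (hf : Integrable f) {y : ℝ} (hy : 0 < y) :
    ∫ t, (∫ x, f x * halfPlanePoisson y x t) ∂μ
      = ∫ x, f x * -(cauchyT μ ((x : ℂ) + y * I)).im := by
  rw [integral_integral_swap (integrable_uncurry_mul_halfPlanePoisson μ hf hy)]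
  refine integral_congr_ae (ae_of_all _ fun x => ?_)
  simp only
  rw [integral_const_mul, im_cauchyT μ (by simpa using hy), ← integral_neg]
  congr 1
  refine integral_congr_ae (ae_of_all _ fun t => ?_)
  simp only [im_inv_sub_ofReal, neg_neg, halfPlanePoisson]

lemma integral_mul_halfPlanePoisson_eq (f : ℝ → ℝ) {y : ℝ} (hy : 0 < y) (t : ℝ) :
    ∫ x, f x * halfPlanePoisson y x t = ∫ u, f (t + y * u) * (1 + u ^ 2)⁻¹ := by
  rw [← integral_add_left_eq_self (μ := volume) (fun x => f x * halfPlanePoisson y x t) t]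
  have h := Measure.integral_comp_mul_left (fun x => f (t + x) * halfPlanePoisson y (t + x) t) y
  rw [abs_of_pos (inv_pos.2 hy), smul_eq_mul, eq_comm, inv_mul_eq_iff_eq_mul₀ hy.ne'] at h
  rw [h, ← integral_const_mul]
  refine integral_congr_ae (ae_of_all _ fun u => ?_)
  simp only [halfPlanePoisson]
  field_simp
  ring

lemma exists_integral_mul_halfPlanePoisson_approx {f : ℝ → ℝ} (hf : Continuous f)
    (hc : HasCompactSupport f) {ε : ℝ} (hε : 0 < ε) :
    ∃ y : ℝ, 0 < y ∧ y < 1 ∧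
      ∀ t, |(∫ x, f x * halfPlanePoisson y x t) - Real.pi * f t| ≤ ε := by
  obtain ⟨M, hM⟩ := hf.bounded_above_of_compact_support hc
  have hM0 : 0 ≤ M := (norm_nonneg _).trans (hM 0)
  have hU := hc.uniformContinuous_of_continuous hf
  obtain ⟨δ, hδ, hδf⟩ := Metric.uniformContinuous_iff.1 hU (ε / (2 * Real.pi)) (by positivity)
  have htail : Tendsto (fun y : ℝ => ∫ u : ℝ, {u : ℝ | δ ≤ y * |u|}.indicator
      (fun u => 2 * M * (1 + u ^ 2)⁻¹) u) (𝓝[>] 0) (𝓝 (∫ _ : ℝ, (0 : ℝ))) := by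
    refine tendsto_integral_filter_of_dominated_convergence (fun u => 2 * M * (1 + u ^ 2)⁻¹)
      (Eventually.of_forall fun y => ?_) (Eventually.of_forall fun y => ae_of_all _ fun u => ?_)
      (integrable_inv_one_add_sq.const_mul _) (ae_of_all _ fun u => ?_)
    · exact (Measurable.indicator (by fun_prop)
        (measurableSet_le measurable_const (by fun_prop))).aestronglyMeasurable
    · refine (norm_indicator_le_norm_self _ _).trans (le_of_eq ?_)
      exact Real.norm_of_nonneg (by positivity)
    · refine tendsto_const_nhds.congr' ?_
      have : Tendsto (fun y : ℝ => y * |u|) (𝓝[>] 0) (𝓝 (0 * |u|)) :=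
        (continuous_id.mul continuous_const).continuousAt.tendsto.mono_left nhdsWithin_le_nhds
      rw [zero_mul] at this
      filter_upwards [this.eventually_lt_const hδ] with y hy
      simp [hy]
  rw [integral_zero] at htail
  have hev := (htail.eventually_lt_const (half_pos hε)).and
    (Ioo_mem_nhdsGT (zero_lt_one (α := ℝ)))
  obtain ⟨y, hy, hy0, hy1⟩ := hev.exists
  refine ⟨y, hy0, hy1, fun t => ?_⟩
  have hi1 : Integrable (fun u : ℝ => f (t + y * u) * (1 + u ^ 2)⁻¹) :=
    integrable_inv_one_add_sq.bdd_mul (c := M) (by fun_prop) (ae_of_all _ fun u => hM _)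
  have hi2 : Integrable (fun u : ℝ => f t * (1 + u ^ 2)⁻¹) :=
    integrable_inv_one_add_sq.const_mul _
  have hi3 : Integrable ({u : ℝ | δ ≤ y * |u|}.indicator
      (fun u => 2 * M * (1 + u ^ 2)⁻¹)) :=
    (integrable_inv_one_add_sq.const_mul _).indicator
      (measurableSet_le measurable_const (by fun_prop))
  have hi4 : Integrable (fun u : ℝ => ε / (2 * Real.pi) * (1 + u ^ 2)⁻¹) :=
    integrable_inv_one_add_sq.const_mul _
  rw [integral_mul_halfPlanePoisson_eq f hy0, mul_comm, ← integral_univ_inv_one_add_sq,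
    ← integral_const_mul, ← integral_sub hi1 hi2, ← Real.norm_eq_abs]
  refine (norm_integral_le_of_norm_le (hi4.add hi3) (ae_of_all _ fun u => ?_)).trans ?_
  · have hp : 0 < (1 + u ^ 2)⁻¹ := by positivity
    rw [← sub_mul, norm_mul, Real.norm_of_nonneg hp.le]
    simp only [Pi.add_apply]
    by_cases hu : δ ≤ y * |u|
    · simp only [Set.indicator, Set.mem_ofPred_eq, hu, if_true]
      have h1 : ‖f (t + y * u) - f t‖ ≤ 2 * M :=
        (norm_sub_le _ _).trans (by linarith [hM (t + y * u), hM t])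
      have h2 : 0 ≤ ε / (2 * Real.pi) * (1 + u ^ 2)⁻¹ := by positivity
      have h3 := mul_le_mul_of_nonneg_right h1 hp.le
      linarith
    · simp only [Set.indicator, Set.mem_ofPred_eq, hu, if_false, add_zero]
      refine mul_le_mul_of_nonneg_right (le_of_lt ?_) hp.le
      rw [← dist_eq_norm]
      refine hδf ?_
      rw [Real.dist_eq, add_sub_cancel_left, abs_mul, abs_of_pos hy0]
      exact not_le.1 hu
  · simp only [Pi.add_apply]
    rw [integral_add hi4 hi3, integral_const_mul, integral_univ_inv_one_add_sq]
    have : ε / (2 * Real.pi) * Real.pi = ε / 2 := by field_simp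
    linarith

section CauchyContinuity

variable {μ : ℕ → Measure ℝ} {μ' : Measure ℝ} [∀ n, IsFiniteMeasure (μ n)] [IsFiniteMeasure μ']

lemma tendsto_integral_of_tendsto_cauchyT_of_hasCompactSupport
    (hmass : Tendsto (fun n => (μ n).real Set.univ) atTop (𝓝 (μ'.real Set.univ)))
    (hG : ∀ z : ℂ, 0 < z.im → z ≠ I →
      Tendsto (fun n => cauchyT (μ n) z) atTop (𝓝 (cauchyT μ' z)))
    {f : ℝ → ℝ} (hf : Continuous f) (hc : HasCompactSupport f) :
    Tendsto (fun n => ∫ x, f x ∂(μ n)) atTop (𝓝 (∫ x, f x ∂μ')) := by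
  obtain ⟨M, hM⟩ := hmass.bddAbove_range
  have hM' : ∀ n, (μ n).real Set.univ ≤ M := fun n => hM ⟨n, rfl⟩
  have hM0 : 0 ≤ M := measureReal_nonneg.trans (hM' 0)
  have hMlim : μ'.real Set.univ ≤ M := le_of_tendsto' hmass hM'
  have hfi : Integrable f := hf.integrable_of_hasCompactSupport hc
  rw [Metric.tendsto_atTop']
  intro ε hε
  obtain ⟨y, hy0, hy1, hy⟩ := exists_integral_mul_halfPlanePoisson_approx hf hc
    (show 0 < ε / (M + 1) by positivity)
  have hP : Tendsto (fun n => ∫ x, f x * -(cauchyT (μ n) ((x : ℂ) + y * I)).im) atTop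
      (𝓝 (∫ x, f x * -(cauchyT μ' ((x : ℂ) + y * I)).im)) := by
    refine tendsto_integral_of_dominated_convergence (fun x => |f x| * (y⁻¹ * M)) (fun n => ?_)
      (hfi.abs.mul_const _) (fun n => ae_of_all _ fun x => ?_) (ae_of_all _ fun x => ?_)
    · exact (hf.mul (Complex.continuous_im.comp
        (continuous_cauchyT_horizontal (μ n) hy0)).neg).aestronglyMeasurable
    · rw [norm_mul, norm_neg, Real.norm_eq_abs, Real.norm_eq_abs]
      refine mul_le_mul_of_nonneg_left ((Complex.abs_im_le_norm _).trans ?_) (abs_nonneg _)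
      refine (norm_cauchyT_le (μ n) (by simpa using hy0)).trans ?_
      simp only [add_im, ofReal_im, mul_im, ofReal_re, I_im, mul_one, I_re, mul_zero, add_zero,
        zero_add]
      have := hM' n
      gcongr
    · refine (((Complex.continuous_im.tendsto _).comp (hG _ (by simpa using hy0) ?_)).neg).const_mul
        _
      intro h
      have := congrArg Complex.im h
      simp at this
      exact hy1.ne this
  have key : ∀ (ρ : Measure ℝ) [IsFiniteMeasure ρ], ρ.real Set.univ ≤ M →
      |(∫ x, f x * -(cauchyT ρ ((x : ℂ) + y * I)).im) - Real.pi * ∫ x, f x ∂ρ| ≤ ε := by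
    intro ρ _ hρ
    have hfρ : Integrable f ρ := hf.integrable_of_hasCompactSupport hc
    have hPρ : Integrable (fun t => ∫ x, f x * halfPlanePoisson y x t) ρ :=
      (integrable_uncurry_mul_halfPlanePoisson ρ hfi hy0).integral_prod_left
    rw [← integral_integral_mul_halfPlanePoisson ρ hfi hy0, ← integral_const_mul,
      ← integral_sub hPρ (hfρ.const_mul _), ← Real.norm_eq_abs]
    refine (norm_integral_le_of_norm_le_const (ae_of_all _ hy)).trans ?_
    rw [div_mul_eq_mul_div, div_le_iff₀ (by positivity)]
    gcongr
    linarith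
  obtain ⟨N, hN⟩ := (Metric.tendsto_atTop'.1 hP) (ε / 2) (half_pos hε)
  refine ⟨N, fun n hn => ?_⟩
  have h1 := key (μ n) (hM' n)
  have h2 := key μ' hMlim
  have h3 := hN n hn
  rw [Real.dist_eq] at h3 ⊢
  obtain ⟨h1a, h1b⟩ := abs_le.1 h1
  obtain ⟨h2a, h2b⟩ := abs_le.1 h2
  obtain ⟨h3a, h3b⟩ := abs_lt.1 h3
  have hpi := Real.pi_gt_three
  rw [abs_lt]
  constructor
  · nlinarith
  · nlinarith

/-- A continuous cutoff equal to `1` on `[-T, T]` and vanishing outside `[-(T + 1), T + 1]`. -/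
def cutoff (T t : ℝ) : ℝ := max 0 (min 1 (T + 1 - |t|))

lemma continuous_cutoff (T : ℝ) : Continuous (cutoff T) := by unfold cutoff; fun_prop

lemma cutoff_nonneg (T t : ℝ) : 0 ≤ cutoff T t := le_max_left _ _

lemma cutoff_le_one (T t : ℝ) : cutoff T t ≤ 1 := max_le zero_le_one (min_le_left _ _)

lemma hasCompactSupport_cutoff (T : ℝ) : HasCompactSupport (cutoff T) := by
  refine HasCompactSupport.intro (isCompact_Icc (a := -(T + 1)) (b := T + 1)) fun t ht => ?_
  rw [Set.mem_Icc, ← abs_le, not_le] at ht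
  exact max_eq_left ((min_le_right _ _).trans (by linarith))

lemma integrable_cutoff (T : ℝ) (ρ : Measure ℝ) [IsFiniteMeasure ρ] : Integrable (cutoff T) ρ :=
  (continuous_cutoff T).integrable_of_hasCompactSupport (hasCompactSupport_cutoff T)

lemma tendsto_integral_cutoff (ρ : Measure ℝ) [IsFiniteMeasure ρ] :
    Tendsto (fun T => ∫ t, cutoff T t ∂ρ) atTop (𝓝 (ρ.real Set.univ)) := by
  have : ρ.real Set.univ = ∫ _ : ℝ, (1 : ℝ) ∂ρ := by simp
  rw [this]
  refine tendsto_integral_filter_of_dominated_convergence (fun _ => 1)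
    (Eventually.of_forall fun T => (continuous_cutoff T).aestronglyMeasurable)
    (Eventually.of_forall fun T => ae_of_all _ fun t => ?_) (integrable_const _)
    (ae_of_all _ fun t => ?_)
  · rw [Real.norm_of_nonneg (cutoff_nonneg T t)]; exact cutoff_le_one T t
  · refine tendsto_const_nhds.congr' ?_
    filter_upwards [eventually_ge_atTop |t|] with T hT
    rw [cutoff, min_eq_left (by linarith), max_eq_right zero_le_one]

/-- Finite measures converge weakly as soon as their masses and their Cauchy transforms converge.
The point `I` may be left out. -/
lemma tendsto_integral_of_tendsto_cauchyT
    (hmass : Tendsto (fun n => (μ n).real Set.univ) atTop (𝓝 (μ'.real Set.univ)))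
    (hG : ∀ z : ℂ, 0 < z.im → z ≠ I →
      Tendsto (fun n => cauchyT (μ n) z) atTop (𝓝 (cauchyT μ' z)))
    (f : BoundedContinuousFunction ℝ ℝ) :
    Tendsto (fun n => ∫ x, f x ∂(μ n)) atTop (𝓝 (∫ x, f x ∂μ')) := by
  have split : ∀ (ρ : Measure ℝ) [IsFiniteMeasure ρ] (T : ℝ),
      |(∫ x, f x ∂ρ) - ∫ x, f x * cutoff T x ∂ρ|
        ≤ ‖f‖ * (ρ.real Set.univ - ∫ x, cutoff T x ∂ρ) := by
    intro ρ _ T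
    have h1 : Integrable f ρ := f.integrable ρ
    have h2 : Integrable (fun x => f x * cutoff T x) ρ :=
      (integrable_cutoff T ρ).bdd_mul (c := ‖f‖) f.continuous.aestronglyMeasurable
        (ae_of_all _ f.norm_coe_le_norm)
    have h3 : ρ.real Set.univ = ∫ _ : ℝ, (1 : ℝ) ∂ρ := by simp
    rw [h3, ← integral_sub h1 h2, ← integral_sub (integrable_const _) (integrable_cutoff T ρ),
      ← integral_const_mul, ← Real.norm_eq_abs]
    refine norm_integral_le_of_norm_le
      (((integrable_const _).sub (integrable_cutoff T ρ)).const_mul _) (ae_of_all _ fun t => ?_)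
    have : f t - f t * cutoff T t = f t * (1 - cutoff T t) := by ring
    rw [this, norm_mul, Real.norm_of_nonneg (sub_nonneg.2 (cutoff_le_one T t))]
    exact mul_le_mul_of_nonneg_right (f.norm_coe_le_norm t) (sub_nonneg.2 (cutoff_le_one T t))
  rw [Metric.tendsto_atTop']
  intro ε hε
  have hF : 0 ≤ ‖f‖ := norm_nonneg f
  obtain ⟨T, hT⟩ := (((tendsto_integral_cutoff μ').const_sub (μ'.real Set.univ)).const_mul
    ‖f‖).eventually_lt_const (u := ε / 4) (by simpa using hε) |>.exists
  have hc1 := tendsto_integral_of_tendsto_cauchyT_of_hasCompactSupport hmass hG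
    (continuous_cutoff T) (hasCompactSupport_cutoff T)
  have hc2 := tendsto_integral_of_tendsto_cauchyT_of_hasCompactSupport hmass hG
    (f := fun x => f x * cutoff T x)
    (f.continuous.mul (continuous_cutoff T)) (hasCompactSupport_cutoff T).mul_left
  have hev1 := ((hmass.sub hc1).const_mul ‖f‖).eventually_lt_const hT
  obtain ⟨N, hN⟩ := Metric.tendsto_atTop'.1 hc2 (ε / 2) (half_pos hε)
  obtain ⟨N', hN'⟩ := eventually_atTop.1 hev1
  refine ⟨max N N', fun n hn => ?_⟩
  have h1 := split (μ n) T
  have h2 := split μ' T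
  have h3 := hN n ((le_max_left _ _).trans_lt hn)
  have h4 := hN' n ((le_max_right _ _).trans hn.le)
  rw [Real.dist_eq] at h3 ⊢
  obtain ⟨h1a, h1b⟩ := abs_le.1 (h1.trans h4.le)
  obtain ⟨h2a, h2b⟩ := abs_le.1 (h2.trans hT.le)
  obtain ⟨h3a, h3b⟩ := abs_lt.1 h3
  rw [abs_lt]
  constructor <;> linarith

lemma tendsto_integral_complex_of_tendsto_integral_real
    (h : ∀ f : BoundedContinuousFunction ℝ ℝ,
      Tendsto (fun n => ∫ x, f x ∂(μ n)) atTop (𝓝 (∫ x, f x ∂μ')))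
    {g : ℝ → ℂ} (hg : Continuous g) {C : ℝ} (hC : ∀ t, ‖g t‖ ≤ C) :
    Tendsto (fun n => ∫ x, g x ∂(μ n)) atTop (𝓝 (∫ x, g x ∂μ')) := by
  let m : ℕ → FiniteMeasure ℝ := fun n => ⟨μ n, inferInstance⟩
  let m' : FiniteMeasure ℝ := ⟨μ', inferInstance⟩
  have hm : Tendsto m atTop (𝓝 m') := FiniteMeasure.tendsto_iff_forall_integral_tendsto.2 h
  exact (FiniteMeasure.tendsto_iff_forall_integral_rclike_tendsto ℂ).1 hm
    (BoundedContinuousFunction.ofNormedAddCommGroup g hg C hC)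

end CauchyContinuity

lemma isFiniteMeasure_withDensity_centerR (ν : Measure ℝ) [IsProbabilityMeasure ν] :
    IsFiniteMeasure ((centerR ν).withDensity fun t => ENNReal.ofReal (t ^ 2 / (1 + t ^ 2))) :=
  isFiniteMeasure_withDensity_ofReal (integrable_sq_div_one_add_sq _).2

/-- `∑_{k < m} t² / (1 + t²) dν_k°(t)`. -/
def centeredSum (m : ℕ) (ν : ℕ → Measure ℝ) : Measure ℝ :=
  ∑ i ∈ Finset.range m,
    (centerR (ν i)).withDensity (fun t => ENNReal.ofReal (t ^ 2 / (1 + t ^ 2)))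

section CenteredSum

variable (m : ℕ) (ν : ℕ → Measure ℝ) [∀ i, IsProbabilityMeasure (ν i)]

instance isFiniteMeasure_centeredSum : IsFiniteMeasure (centeredSum m ν) := by
  have := fun i => isFiniteMeasure_withDensity_centerR (ν i)
  unfold centeredSum
  infer_instance

lemma integral_centeredSum {E : Type*} [NormedAddCommGroup E] [NormedSpace ℝ E] {g : ℝ → E}
    (hg : Continuous g) {C : ℝ} (hC : ∀ t, ‖g t‖ ≤ C) :
    ∫ t, g t ∂(centeredSum m ν)
      = ∑ i ∈ Finset.range m, ∫ t, (t ^ 2 / (1 + t ^ 2)) • g t ∂(centerR (ν i)) := by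
  have := fun i => isFiniteMeasure_withDensity_centerR (ν i)
  rw [centeredSum, integral_finsetSum_measure fun i _ =>
    Integrable.of_bound hg.aestronglyMeasurable C (ae_of_all _ hC)]
  refine Finset.sum_congr rfl fun i _ => ?_
  rw [integral_withDensity_eq_integral_toReal_smul (by fun_prop)
    (ae_of_all _ fun _ => ENNReal.ofReal_lt_top)]
  refine integral_congr_ae (ae_of_all _ fun t => ?_)
  simp only [ENNReal.toReal_ofReal (sq_div_one_add_sq_nonneg t)]

lemma centeredSum_real_univ :
    (centeredSum m ν).real Set.univ = ∑ i ∈ Finset.range m, centeredMass (ν i) := by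
  have h := integral_centeredSum m ν (g := fun _ => (1 : ℝ)) continuous_const (C := 1) (by simp)
  simpa [centeredMass] using h

end CenteredSum

lemma continuous_nevanlinna_kernel {z : ℂ} (hz : 0 < z.im) :
    Continuous (fun s : ℝ => (1 + (s : ℂ) * z) / (z - s)) :=
  Continuous.div (by fun_prop) (by fun_prop) fun s => sub_ofReal_ne_zero hz s

lemma integral_nevanlinna_kernel (ρ : Measure ℝ) [IsFiniteMeasure ρ] {z : ℂ} (hz : 0 < z.im) :
    ∫ s : ℝ, (1 + (s : ℂ) * z) / (z - s) ∂ρ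
      = -z * (ρ.real Set.univ : ℂ) + (1 + z ^ 2) * cauchyT ρ z := by
  have : ∀ s : ℝ, (1 + (s : ℂ) * z) / (z - s) = -z + (1 + z ^ 2) * (z - (s : ℂ))⁻¹ := by
    intro s
    have := sub_ofReal_ne_zero hz s
    field_simp
    ring
  simp_rw [this]
  rw [integral_add (integrable_const _) ((integrable_inv_sub_ofReal ρ hz).const_mul _),
    integral_const_mul, integral_const, cauchyT]
  simp [mul_comm]

lemma one_add_sq_ne_zero_of_ne_I {z : ℂ} (hz : 0 < z.im) (hI : z ≠ I) : 1 + z ^ 2 ≠ 0 := by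
  have h : 1 + z ^ 2 = (z - I) * (z + I) := by ring_nf; rw [I_sq]; ring
  rw [h]
  refine mul_ne_zero (sub_ne_zero.2 hI) fun h' => ?_
  have := congrArg Complex.im h'
  simp at this
  linarith

lemma cauchyT_eq_inv_sub_ET (μ : Measure ℝ) (z : ℂ) : cauchyT μ z = (z - ET μ z)⁻¹ := by
  rw [ET, sub_sub_cancel, inv_inv]

section Boolean

variable {kn : ℕ → ℕ} {ν : ℕ → ℕ → Measure ℝ} [∀ n i, IsProbabilityMeasure (ν n i)]

lemma eventually_norm_ET_sub_le (hinf : IsInfinitesimalArrayR kn ν) {c : ℕ → ℝ}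
    {ω : ℕ → Measure ℝ}
    (hωE : ∀ n : ℕ, ∀ z : ℂ, 0 < z.im →
      ET (ω n) z = ((c n : ℝ) : ℂ) + ∑ i ∈ Finset.range (kn n), ET (ν n i) z)
    {z : ℂ} (hz : 0 < z.im) {ε : ℝ} (hε : 0 < ε) :
    ∀ᶠ n in atTop, ‖ET (ω n) z - (((c n + ∑ i ∈ Finset.range (kn n),
        (aR (ν n i) + ∫ t : ℝ, t / (1 + t ^ 2) ∂(centerR (ν n i))) : ℝ) : ℂ)
        + ∫ s : ℝ, (1 + (s : ℂ) * z) / (z - s) ∂(centeredSum (kn n) (ν n)))‖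
      ≤ ε * (centeredSum (kn n) (ν n)).real Set.univ := by
  obtain ⟨C, ε₀, hC, hε₀, H⟩ := exists_norm_ET_sub_le hz
  obtain ⟨K, hK0, hK⟩ := exists_norm_nevanlinna_kernel_le hz
  set η := min ε₀ (ε / (C + 1)) with hη
  have hη0 : 0 < η := by positivity
  have hCη : C * η ≤ ε := by
    have h1 : η ≤ ε / (C + 1) := min_le_right _ _
    rw [le_div_iff₀ (by positivity)] at h1
    linarith
  obtain ⟨N, hN⟩ := hinf η hη0 (ENNReal.ofReal η) (by simpa using hη0)
  filter_upwards [eventually_ge_atTop N] with n hn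
  rw [hωE n z hz, integral_centeredSum (kn n) (ν n) (continuous_nevanlinna_kernel hz) hK,
    centeredSum_real_univ, Finset.mul_sum]
  push_cast
  rw [add_assoc (c n : ℂ), add_sub_add_left_eq_sub, ← Finset.sum_add_distrib,
    ← Finset.sum_sub_distrib]
  refine norm_sum_le_of_le _ fun i hi => ?_
  have h := H (ν n i) inferInstance η hη0 (min_le_left _ _) (hN n hn i (Finset.mem_range.1 hi))
  push_cast at h
  simp only [Complex.real_smul]
  push_cast
  exact h.trans (mul_le_mul_of_nonneg_right hCη (centeredMass_nonneg _))

lemma tendsto_ET_sub_zero (hinf : IsInfinitesimalArrayR kn ν) {c : ℕ → ℝ}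
    {ω : ℕ → Measure ℝ}
    (hωE : ∀ n : ℕ, ∀ z : ℂ, 0 < z.im →
      ET (ω n) z = ((c n : ℝ) : ℂ) + ∑ i ∈ Finset.range (kn n), ET (ν n i) z)
    {B : ℝ} (hB : ∀ᶠ n in atTop, (centeredSum (kn n) (ν n)).real Set.univ ≤ B)
    {z : ℂ} (hz : 0 < z.im) :
    Tendsto (fun n => ET (ω n) z - (((c n + ∑ i ∈ Finset.range (kn n),
        (aR (ν n i) + ∫ t : ℝ, t / (1 + t ^ 2) ∂(centerR (ν n i))) : ℝ) : ℂ)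
        + ∫ s : ℝ, (1 + (s : ℂ) * z) / (z - s) ∂(centeredSum (kn n) (ν n)))) atTop (𝓝 0) := by
  have hB0 : 0 ≤ B := by
    obtain ⟨n, hn⟩ := hB.exists
    exact measureReal_nonneg.trans hn
  rw [Metric.tendsto_nhds]
  intro ε hε
  filter_upwards [hB, eventually_norm_ET_sub_le hinf hωE hz
    (show 0 < ε / (B + 1) by positivity)] with n h1 h2
  rw [dist_zero_right]
  refine h2.trans_lt ?_
  rw [div_mul_eq_mul_div, div_lt_iff₀ (by positivity)]
  gcongr
  linarith

end Boolean

lemma nevanlinna_kernel_I (s : ℝ) : (1 + (s : ℂ) * I) / (I - s) = -I := by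
  have h : I - (s : ℂ) ≠ 0 := sub_ofReal_ne_zero (by simp) s
  rw [div_eq_iff h]
  ring_nf
  rw [I_sq]
  ring

lemma integral_nevanlinna_kernel_I (ρ : Measure ℝ) [IsFiniteMeasure ρ] :
    ∫ s : ℝ, (1 + (s : ℂ) * I) / (I - s) ∂ρ = -((ρ.real Set.univ : ℂ) * I) := by
  simp_rw [nevanlinna_kernel_I]
  simp

/-- Theorem 5.3, (3) ⇔ (4): the boolean convolutions ω_n = δ_{c_n} ⊎ ν_{n1} ⊎ ⋯ ⊎ ν_{nk_n}
converge weakly to ν_⊎^{γ,σ} iff dσ_n(t) = Σ_k t²/(1+t²) dν_{nk}°(t) → σ weakly and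
γ_n = c_n + Σ_k [a_{nk} + ∫ t/(1+t²) dν_{nk}°] → γ. -/
theorem stmt18
    (kn : ℕ → ℕ) (ν : ℕ → ℕ → Measure ℝ)
    (hprob : ∀ n i, IsProbabilityMeasure (ν n i))
    (hinf : IsInfinitesimalArrayR kn ν)
    (c : ℕ → ℝ) (γ : ℝ) (σ : Measure ℝ) (hσ : IsFiniteMeasure σ)
    (ω : ℕ → Measure ℝ) (hω : ∀ n, IsProbabilityMeasure (ω n))
    (hωE : ∀ n : ℕ, ∀ z : ℂ, 0 < z.im →
      ET (ω n) z = ((c n : ℝ) : ℂ) + ∑ i ∈ Finset.range (kn n), ET (ν n i) z)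
    (νlim : Measure ℝ) (hνlim : IsProbabilityMeasure νlim)
    (hνE : ∀ z : ℂ, 0 < z.im →
      ET νlim z = ((γ : ℝ) : ℂ) + ∫ t : ℝ, (1 + (t : ℂ) * z) / (z - (t : ℂ)) ∂σ) :
    (∀ f : BoundedContinuousFunction ℝ ℝ,
      Tendsto (fun n => ∫ x, f x ∂(ω n)) atTop (𝓝 (∫ x, f x ∂νlim))) ↔
    ((∀ f : BoundedContinuousFunction ℝ ℝ,
      Tendsto (fun n => ∫ x, f x
          ∂(∑ i ∈ Finset.range (kn n),
            (centerR (ν n i)).withDensity (fun t => ENNReal.ofReal (t ^ 2 / (1 + t ^ 2)))))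
        atTop (𝓝 (∫ x, f x ∂σ))) ∧
     Tendsto (fun n => c n + ∑ i ∈ Finset.range (kn n),
        (aR (ν n i) + ∫ t : ℝ, t / (1 + t ^ 2) ∂(centerR (ν n i))))
       atTop (𝓝 γ)) := by
  set γn : ℕ → ℝ := fun n => c n + ∑ i ∈ Finset.range (kn n),
    (aR (ν n i) + ∫ t : ℝ, t / (1 + t ^ 2) ∂(centerR (ν n i))) with hγn
  change _ ↔ (∀ f : BoundedContinuousFunction ℝ ℝ, Tendsto
    (fun n => ∫ x, f x ∂(centeredSum (kn n) (ν n))) atTop (𝓝 (∫ x, f x ∂σ))) ∧ _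
  constructor
  · intro hweak
    have hE : ∀ z : ℂ, 0 < z.im → Tendsto (fun n => ET (ω n) z) atTop (𝓝 (ET νlim z)) := by
      intro z hz
      have h := tendsto_integral_complex_of_tendsto_integral_real hweak
        (continuous_inv_sub_ofReal hz) (norm_inv_sub_ofReal_le hz)
      exact (h.inv₀ (cauchyT_ne_zero νlim hz)).const_sub z
    have hI : 0 < I.im := by simp
    have hbound : ∀ᶠ n in atTop,
        (centeredSum (kn n) (ν n)).real Set.univ ≤ 2 * (‖ET νlim I‖ + 1) := by
      filter_upwards [eventually_norm_ET_sub_le hinf hωE hI one_half_pos,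
        (hE I hI).norm.eventually_lt_const (lt_add_one _)] with n h1 h2
      rw [integral_nevanlinna_kernel_I] at h1
      have h3 := (Complex.abs_im_le_norm _).trans h1
      have h4 := Complex.abs_im_le_norm (ET (ω n) I)
      simp only [sub_im, add_im, ofReal_im, neg_im, mul_im, ofReal_re, I_im, I_re, mul_one,
        mul_zero, add_zero, zero_add] at h3
      have h5 := (abs_le.1 h3).2
      have h6 := (abs_le.1 h4).1
      linarith
    have hΦ : ∀ z : ℂ, 0 < z.im → Tendsto (fun n => (γn n : ℂ)
        + ∫ s : ℝ, (1 + (s : ℂ) * z) / (z - s) ∂(centeredSum (kn n) (ν n))) atTop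
        (𝓝 ((γ : ℂ) + ∫ s : ℝ, (1 + (s : ℂ) * z) / (z - s) ∂σ)) := by
      intro z hz
      have h := (hE z hz).sub (tendsto_ET_sub_zero hinf hωE hbound hz)
      rw [hνE z hz, sub_zero] at h
      exact h.congr fun n => by rw [sub_sub_cancel]
    have hΦI := hΦ I hI
    simp_rw [integral_nevanlinna_kernel_I] at hΦI
    have hγ : Tendsto γn atTop (𝓝 γ) := by
      simpa [Function.comp_def] using (Complex.continuous_re.tendsto _).comp hΦI
    have hmass : Tendsto (fun n => (centeredSum (kn n) (ν n)).real Set.univ) atTop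
        (𝓝 (σ.real Set.univ)) := by
      have h := ((Complex.continuous_im.tendsto _).comp hΦI).neg
      simpa using h
    refine ⟨tendsto_integral_of_tendsto_cauchyT hmass fun z hz hzI => ?_, hγ⟩
    have hγ' : Tendsto (fun n => (γn n : ℂ)) atTop (𝓝 (γ : ℂ)) :=
      (continuous_ofReal.tendsto _).comp hγ
    have hmass' : Tendsto (fun n => ((centeredSum (kn n) (ν n)).real Set.univ : ℂ)) atTop
        (𝓝 (σ.real Set.univ : ℂ)) := (continuous_ofReal.tendsto _).comp hmass
    have h := (((hΦ z hz).sub hγ').sub (hmass'.const_mul (-z))).const_mul (1 + z ^ 2)⁻¹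
    have hne := one_add_sq_ne_zero_of_ne_I hz hzI
    have hform : ∀ (ρ : Measure ℝ) [IsFiniteMeasure ρ] (g : ℂ), (1 + z ^ 2)⁻¹ *
        (g + (∫ s : ℝ, (1 + (s : ℂ) * z) / (z - s) ∂ρ) - g - -z * (ρ.real Set.univ : ℂ))
        = cauchyT ρ z := by
      intro ρ _ g
      rw [integral_nevanlinna_kernel ρ hz, inv_mul_eq_iff_eq_mul₀ hne]
      ring
    rw [hform σ] at h
    exact h.congr fun n => hform _ _
  · rintro ⟨hweak, hγ⟩
    have hmass : Tendsto (fun n => (centeredSum (kn n) (ν n)).real Set.univ) atTop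
        (𝓝 (σ.real Set.univ)) := by
      simpa using hweak (BoundedContinuousFunction.const ℝ 1)
    have hbound : ∀ᶠ n in atTop,
        (centeredSum (kn n) (ν n)).real Set.univ ≤ σ.real Set.univ + 1 :=
      hmass.eventually_le_const (lt_add_one _)
    refine tendsto_integral_of_tendsto_cauchyT (by simp) fun z hz _ => ?_
    obtain ⟨K, -, hK⟩ := exists_norm_nevanlinna_kernel_le hz
    have hγ' : Tendsto (fun n => (γn n : ℂ)) atTop (𝓝 (γ : ℂ)) :=
      (continuous_ofReal.tendsto _).comp hγ
    have h := (tendsto_ET_sub_zero hinf hωE hbound hz).add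
      (hγ'.add (tendsto_integral_complex_of_tendsto_integral_real hweak
        (continuous_nevanlinna_kernel hz) hK))
    rw [zero_add, ← hνE z hz] at h
    have hE : Tendsto (fun n => ET (ω n) z) atTop (𝓝 (ET νlim z)) :=
      h.congr fun n => by rw [sub_add_cancel]
    simp_rw [cauchyT_eq_inv_sub_ET _ z]
    refine (hE.const_sub z).inv₀ ?_
    rw [ET, sub_sub_cancel]
    exact inv_ne_zero (cauchyT_ne_zero νlim hz)

end
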